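/- arXiv:1810.04336 — 3 statements merged into one kernel-verified Lean document; each statement's English description precedes it below -/
import Mathlib

section
/- Let 𝒳 = [0, s]^d ⊆ ℝ^d be a hypercube with side length s > 0, let f : ℝ^d → ℝ be L-Lipschitz with respect to the Euclidean norm with L > 0, let x* ∈ 𝒳 be a global maximizer of f on 𝒳, and let ε > 0 satisfy ε/L ≤ s. Then the Lebesgue measure of the set { x ∈ 𝒳 : f(x*) - f(x) ≤ ε } is at least 2^{-d} times the Lebesgue measure of a closed Euclidean ball of radius ε/L in ℝ^d, i.e. at least π^{d/2} (ε/L)^d / (2^d · Γ(d/2 + 1)). -/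
open MeasureTheory Set

/-- The map of `[0, s]` that translates `[0, s - c]` onto `[c, s]` and reflects `(s - c, s]`
onto `[0, c)`. -/
noncomputable def foldAt (s c y : ℝ) : ℝ := if y ≤ s - c then c + y else s - y

theorem abs_foldAt_sub_le {s c y : ℝ} (hc : c ∈ Icc 0 s) (hy : y ∈ Icc 0 s) :
    |foldAt s c y - c| ≤ y := by
  obtain ⟨hc0, hcs⟩ := hc
  obtain ⟨hy0, hys⟩ := hy
  unfold foldAt
  split_ifs with h <;> rw [abs_le] <;> constructor <;> linarith

theorem measurable_foldAt (s c : ℝ) : Measurable (foldAt s c) :=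
  Measurable.ite measurableSet_Iic (by fun_prop) (by fun_prop)

theorem measurePreserving_foldAt {s c : ℝ} (hc : c ∈ Icc 0 s) :
    MeasurePreserving (foldAt s c) (volume.restrict (Icc 0 s)) (volume.restrict (Icc 0 s)) := by
  obtain ⟨hc0, hcs⟩ := hc
  refine ⟨measurable_foldAt s c, Measure.ext fun A hA => ?_⟩
  rw [Measure.map_apply (measurable_foldAt s c) hA, Measure.restrict_apply hA,
    Measure.restrict_apply (measurable_foldAt s c hA)]
  have hsource : foldAt s c ⁻¹' A ∩ Icc 0 s =
      (fun y => c + y) ⁻¹' (A ∩ Icc c s) ∪ (fun y => s - y) ⁻¹' (A ∩ Ico 0 c) := by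
    ext y
    simp only [foldAt, mem_inter_iff, mem_preimage, mem_union, mem_Icc, mem_Ico]
    split_ifs with h
    · constructor
      · rintro ⟨hA, h0, h1⟩
        exact Or.inl ⟨hA, by linarith, by linarith⟩
      · rintro (⟨hA, h0, h1⟩ | ⟨hA, h0, h1⟩)
        · exact ⟨hA, by linarith, by linarith⟩
        · linarith
    · constructor
      · rintro ⟨hA, h0, h1⟩
        exact Or.inr ⟨hA, by linarith, by linarith⟩
      · rintro (⟨hA, h0, h1⟩ | ⟨hA, h0, h1⟩)
        · linarith
        · exact ⟨hA, by linarith, by linarith⟩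
  have htarget : A ∩ Icc 0 s = (A ∩ Icc c s) ∪ (A ∩ Ico 0 c) := by
    rw [← inter_union_distrib_left, union_comm, Ico_union_Icc_eq_Icc hc0 hcs]
  have hmeas : MeasurableSet (A ∩ Ico 0 c) := hA.inter measurableSet_Ico
  rw [hsource, htarget, measure_union _ (hmeas.preimage (by fun_prop)), measure_union _ hmeas,
    measure_preimage_add, (Measure.measurePreserving_sub_left volume s).measure_preimage
      hmeas.nullMeasurableSet]
  · exact disjoint_left.2 fun y h h' => absurd h.2.1 (not_le.2 h'.2.2)
  · refine disjoint_left.2 fun y h h' => ?_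
    have h1 := h.2.2
    have h2 := h'.2.2
    linarith

theorem measurePreserving_two_mul_abs (s : ℝ) :
    MeasurePreserving (fun y : ℝ => 2 * |y|) (volume.restrict (Icc (-(s / 2)) (s / 2)))
      (volume.restrict (Icc 0 s)) := by
  have hm : Measurable fun y : ℝ => 2 * |y| := by fun_prop
  refine ⟨hm, Measure.ext fun A hA => ?_⟩
  rw [Measure.map_apply hm hA, Measure.restrict_apply hA, Measure.restrict_apply (hm hA)]
  have hsource : (fun y : ℝ => 2 * |y|) ⁻¹' A ∩ Icc (-(s / 2)) (s / 2) =
      (fun y => 2 * y) ⁻¹' (A ∩ Icc 0 s) ∪ (fun y => -2 * y) ⁻¹' (A ∩ Ioc 0 s) := by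
    ext y
    simp only [mem_inter_iff, mem_preimage, mem_union, mem_Icc, mem_Ioc]
    rcases le_or_gt 0 y with h | h
    · rw [abs_of_nonneg h]
      constructor
      · rintro ⟨hA, h0, h1⟩
        exact Or.inl ⟨hA, by linarith, by linarith⟩
      · rintro (⟨hA, h0, h1⟩ | ⟨hA, h0, h1⟩)
        · exact ⟨hA, by linarith, by linarith⟩
        · linarith
    · rw [abs_of_neg h, mul_neg, ← neg_mul]
      constructor
      · rintro ⟨hA, h0, h1⟩
        exact Or.inr ⟨hA, by linarith, by linarith⟩
      · rintro (⟨hA, h0, h1⟩ | ⟨hA, h0, h1⟩)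
        · linarith
        · exact ⟨hA, by linarith, by linarith⟩
  have hIoc : volume (A ∩ Ioc 0 s) = volume (A ∩ Icc 0 s) :=
    measure_congr ((Filter.EventuallyEq.refl _ A).inter Ioc_ae_eq_Icc)
  have hmeas : MeasurableSet (A ∩ Ioc 0 s) := hA.inter measurableSet_Ioc
  rw [hsource, measure_union _ (hmeas.preimage (by fun_prop)),
    Real.volume_preimage_mul_left two_ne_zero,
    Real.volume_preimage_mul_left (neg_ne_zero.2 two_ne_zero), hIoc, ← add_mul,
    ← ENNReal.ofReal_add (abs_nonneg _) (abs_nonneg _)]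
  · norm_num
  · refine disjoint_left.2 fun y h h' => ?_
    have h1 := h.2.1
    have h2 := h'.2.1
    linarith

/-- A cube of side length at least `r` captures, of the ball of radius `r` around any of its
points, at least the volume of a ball of radius `r / 2`. -/
theorem volume_closedBall_half_le_volume_inter_cube {ι : Type*} [Fintype ι] {s r : ℝ}
    (hrs : r ≤ s) {c : EuclideanSpace ℝ ι} (hc : ∀ j, c j ∈ Icc 0 s) :
    volume (Metric.closedBall (0 : EuclideanSpace ℝ ι) (r / 2)) ≤
      volume ({x : EuclideanSpace ℝ ι | ∀ j, x j ∈ Icc 0 s} ∩ Metric.closedBall c r) := by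
  let T : (ι → ℝ) → ι → ℝ := fun x j => foldAt s (c j) (2 * |x j|)
  have hT : MeasurePreserving T (volume.restrict (univ.pi fun _ => Icc (-(s / 2)) (s / 2)))
      (volume.restrict (univ.pi fun _ => Icc 0 s)) := by
    rw [volume_pi, Measure.restrict_pi_pi, Measure.restrict_pi_pi]
    exact measurePreserving_pi _ _ fun j =>
      (measurePreserving_foldAt (hc j)).comp (measurePreserving_two_mul_abs s)
  have htoLp := PiLp.volume_preserving_toLp ι
  have hcube : MeasurableSet (univ.pi fun _ : ι => Icc (0 : ℝ) s) :=
    MeasurableSet.univ_pi fun _ => measurableSet_Icc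
  have hcube' : MeasurableSet {x : EuclideanSpace ℝ ι | ∀ j, x j ∈ Icc 0 s} := by
    have := hcube.preimage (PiLp.volume_preserving_ofLp ι).measurable
    simpa only [preimage, mem_univ_pi] using this
  have hball : MeasurableSet
      (WithLp.toLp 2 ⁻¹' Metric.closedBall c r : Set (ι → ℝ)) :=
    Metric.isClosed_closedBall.measurableSet.preimage htoLp.measurable
  rw [← htoLp.measure_preimage Metric.isClosed_closedBall.measurableSet.nullMeasurableSet,
    ← htoLp.measure_preimage
      (hcube'.inter Metric.isClosed_closedBall.measurableSet).nullMeasurableSet]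
  have htarget : volume (WithLp.toLp 2 ⁻¹'
        ({x : EuclideanSpace ℝ ι | ∀ j, x j ∈ Icc 0 s} ∩ Metric.closedBall c r)) =
      volume.restrict (univ.pi fun _ : ι => Icc (0 : ℝ) s)
        (WithLp.toLp 2 ⁻¹' Metric.closedBall c r) := by
    rw [Measure.restrict_apply hball]
    congr 1
    ext x
    simp only [mem_preimage, mem_inter_iff, mem_univ_pi, mem_ofPred_eq]
    exact and_comm
  rw [htarget, ← hT.measure_preimage hball.nullMeasurableSet,
    Measure.restrict_apply (hT.measurable hball)]
  refine measure_mono fun x hx => ?_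
  have hx' : ‖(WithLp.toLp 2 x : EuclideanSpace ℝ ι)‖ ≤ r / 2 := by
    simpa only [mem_preimage, mem_closedBall_zero_iff] using hx
  have hcoord : ∀ j, |x j| ≤ s / 2 := fun j =>
    (PiLp.norm_apply_le (WithLp.toLp 2 x : EuclideanSpace ℝ ι) j).trans (by linarith)
  refine ⟨?_, fun j _ => abs_le.1 (hcoord j)⟩
  have hnorm : ‖(WithLp.toLp 2 (T x) : EuclideanSpace ℝ ι) - c‖ ≤
      ‖(2 : ℝ) • (WithLp.toLp 2 x : EuclideanSpace ℝ ι)‖ := by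
    rw [EuclideanSpace.norm_eq, EuclideanSpace.norm_eq]
    gcongr with j
    have := abs_foldAt_sub_le (hc j)
      (show 2 * |x j| ∈ Icc 0 s from ⟨by positivity, by linarith [hcoord j]⟩)
    simpa [T, abs_mul] using this
  rw [mem_preimage, mem_preimage, mem_closedBall_iff_norm]
  refine hnorm.trans ?_
  rw [norm_smul, Real.norm_ofNat]
  linarith

theorem volume_closedBall_half {d : ℕ} (x : EuclideanSpace ℝ (Fin d)) {r : ℝ} (hr : 0 < r) :
    volume (Metric.closedBall x (r / 2)) =
      ENNReal.ofReal (Real.pi ^ ((d : ℝ) / 2) * r ^ d /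
        (2 ^ d * Real.Gamma ((d : ℝ) / 2 + 1))) := by
  rcases Nat.eq_zero_or_pos d with rfl | hd
  · have : Metric.closedBall x (r / 2) = univ := eq_univ_of_forall fun y => by
      rw [Subsingleton.elim y x]
      exact Metric.mem_closedBall_self (by positivity)
    simp [this, volume_euclideanSpace_eq_dirac]
  · have : Nonempty (Fin d) := ⟨⟨0, hd⟩⟩
    rw [EuclideanSpace.volume_closedBall, Fintype.card_fin, ← ENNReal.ofReal_pow (by positivity),
      ← ENNReal.ofReal_mul (by positivity)]
    congr 1
    rw [Real.sqrt_eq_rpow, ← Real.rpow_mul_natCast Real.pi_pos.le, div_pow,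
      one_div_mul_eq_div]
    field_simp

/-- For the hypercube `𝒳 = [0,s]^d` (`s > 0`), an `L`-Lipschitz
`f : ℝ^d → ℝ` (`L > 0`) with global maximizer `x* ∈ 𝒳`, and `ε > 0` with `ε/L ≤ s`,
the Lebesgue measure of `{x ∈ 𝒳 : f(x*) - f(x) ≤ ε}` is at least
`π^(d/2) (ε/L)^d / (2^d Γ(d/2 + 1))`, i.e. `2^{-d}` times the volume of a Euclidean ball
of radius `ε/L` in `ℝ^d`. -/
theorem eps_optimal_set_volume_lower_bound {d : ℕ} (s : ℝ) (hs : 0 < s)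
    (f : EuclideanSpace ℝ (Fin d) → ℝ) (L : ℝ) (hL : 0 < L)
    (hf : ∀ x x' : EuclideanSpace ℝ (Fin d), |f x - f x'| ≤ L * ‖x - x'‖)
    (xstar : EuclideanSpace ℝ (Fin d)) (hxstar : ∀ j, xstar j ∈ Set.Icc 0 s)
    (hopt : ∀ x : EuclideanSpace ℝ (Fin d), (∀ j, x j ∈ Set.Icc 0 s) → f x ≤ f xstar)
    (ε : ℝ) (hε : 0 < ε) (hεs : ε / L ≤ s) :
    ENNReal.ofReal (Real.pi ^ ((d : ℝ) / 2) * (ε / L) ^ d /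
        (2 ^ d * Real.Gamma ((d : ℝ) / 2 + 1))) ≤
      MeasureTheory.volume
        {x : EuclideanSpace ℝ (Fin d) | (∀ j, x j ∈ Set.Icc 0 s) ∧ f xstar - f x ≤ ε} := by
  rw [← volume_closedBall_half 0 (by positivity : 0 < ε / L)]
  refine (volume_closedBall_half_le_volume_inter_cube hεs hxstar).trans
    (measure_mono fun x hx => ⟨hx.1, ?_⟩)
  have hdist : ‖xstar - x‖ ≤ ε / L := mem_closedBall_iff_norm'.1 hx.2
  calc f xstar - f x ≤ L * ‖xstar - x‖ := (le_abs_self _).trans (hf _ _)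
    _ ≤ L * (ε / L) := by gcongr
    _ = ε := by field_simp
end

section
/- Let f : ℝ^d → ℝ be L-Lipschitz with respect to the Euclidean norm with L ≥ 0, let x*, x₁, …, x_T ∈ ℝ^d, and for each t ∈ {2, …, T} let f^u_{t-1} and f^l_{t-1} denote the Lipschitz upper and lower bound functions built from the points x₁, …, x_{t-1}. Suppose real numbers μ_t(·)-values, σ_t(·)-values and c ≥ 0 are given such that for every t ∈ {2, …, T}: (i) f(x*) ≤ min{ f^u_{t-1}(x*), μ_{t-1}(x*) + c σ_{t-1}(x*) }; (ii) f^l_{t-1}(x_t) ≤ μ_{t-1}(x_t) + c σ_{t-1}(x_t) ≤ f^u_{t-1}(x_t); (iii) μ_{t-1}(x_t) + c σ_{t-1}(x_t) ≥ μ_{t-1}(x*) + c σ_{t-1}(x*); and (iv) |f(x_t) - μ_{t-1}(x_t)| ≤ c σ_{t-1}(x_t). Then the cumulative regret satisfies Σ_{t=2}^{T} ( f(x*) - f(x_t) ) ≤ min{ 2c Σ_{t=2}^{T} σ_{t-1}(x_t), 2L Σ_{t=2}^{T} min_{i ∈ [t-1]} ‖x_t - x_i‖₂ }. -/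
/-- The Lipschitz upper bound `f^u_m(x) = min_{i ∈ [m]} ( f(xᵢ) + L‖x - xᵢ‖ )` built from
the points `x₁, …, x_m` (junk value `0` when `m = 0`). -/
noncomputable def lipUpper {d : ℕ} (f : EuclideanSpace ℝ (Fin d) → ℝ) (L : ℝ)
    (xs : ℕ → EuclideanSpace ℝ (Fin d)) (m : ℕ) (x : EuclideanSpace ℝ (Fin d)) : ℝ :=
  if hm : 1 ≤ m then
    (Finset.Icc 1 m).inf' (by rw [Finset.nonempty_Icc]; omega)
      (fun i => f (xs i) + L * ‖x - xs i‖)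
  else 0

/-- The Lipschitz lower bound `f^l_m(x) = max_{i ∈ [m]} ( f(xᵢ) - L‖x - xᵢ‖ )` built from
the points `x₁, …, x_m` (junk value `0` when `m = 0`). -/
noncomputable def lipLower {d : ℕ} (f : EuclideanSpace ℝ (Fin d) → ℝ) (L : ℝ)
    (xs : ℕ → EuclideanSpace ℝ (Fin d)) (m : ℕ) (x : EuclideanSpace ℝ (Fin d)) : ℝ :=
  if hm : 1 ≤ m then
    (Finset.Icc 1 m).sup' (by rw [Finset.nonempty_Icc]; omega)
      (fun i => f (xs i) - L * ‖x - xs i‖)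
  else 0

/-- The distance from `x` to the nearest of the points `x₁, …, x_m`:
`min_{i ∈ [m]} ‖x - xᵢ‖` (junk value `0` when `m = 0`). -/
noncomputable def nearestDist {d : ℕ} (xs : ℕ → EuclideanSpace ℝ (Fin d)) (m : ℕ)
    (x : EuclideanSpace ℝ (Fin d)) : ℝ :=
  if hm : 1 ≤ m then
    (Finset.Icc 1 m).inf' (by rw [Finset.nonempty_Icc]; omega) (fun i => ‖x - xs i‖)
  else 0

/-- The Lipschitz upper bound of an `L`-Lipschitz function exceeds it by at most `2L` times the
distance to the nearest data point. -/
theorem lipUpper_le_add_nearestDist {d : ℕ} {f : EuclideanSpace ℝ (Fin d) → ℝ} {L : ℝ}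
    (hf : ∀ x x' : EuclideanSpace ℝ (Fin d), |f x - f x'| ≤ L * ‖x - x'‖)
    (xs : ℕ → EuclideanSpace ℝ (Fin d)) {m : ℕ} (hm : 1 ≤ m) (x : EuclideanSpace ℝ (Fin d)) :
    lipUpper f L xs m x ≤ f x + 2 * L * nearestDist xs m x := by
  have hne : (Finset.Icc 1 m).Nonempty := Finset.nonempty_Icc.2 hm
  obtain ⟨i, hi, hdist⟩ := Finset.exists_mem_eq_inf' hne (fun i => ‖x - xs i‖)
  have hupper := Finset.inf'_le (fun i => f (xs i) + L * ‖x - xs i‖) hi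
  have hlip := (abs_le.1 (hf x (xs i))).1
  simp only [lipUpper, nearestDist, dif_pos hm, hdist]
  linarith

/-- Cumulative regret bound for AR-UCB: under, for every `t ∈ {2,…,T}`,
(i) `f(x*) ≤ min{f^u_{t-1}(x*), μ_{t-1}(x*) + c σ_{t-1}(x*)}`,
(ii) `f^l_{t-1}(xₜ) ≤ μ_{t-1}(xₜ) + c σ_{t-1}(xₜ) ≤ f^u_{t-1}(xₜ)`,
(iii) `μ_{t-1}(xₜ) + c σ_{t-1}(xₜ) ≥ μ_{t-1}(x*) + c σ_{t-1}(x*)`, and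
(iv) `|f(xₜ) - μ_{t-1}(xₜ)| ≤ c σ_{t-1}(xₜ)`, the cumulative regret satisfies
`Σ_{t=2}^T (f(x*) - f(xₜ)) ≤ min{2c Σ σ_{t-1}(xₜ), 2L Σ min_{i∈[t-1]} ‖xₜ - xᵢ‖}`. -/
theorem ar_ucb_cumulative_regret {d : ℕ}
    (f : EuclideanSpace ℝ (Fin d) → ℝ) (L : ℝ) (hL : 0 ≤ L)
    (hf : ∀ x x' : EuclideanSpace ℝ (Fin d), |f x - f x'| ≤ L * ‖x - x'‖)
    (T : ℕ) (xstar : EuclideanSpace ℝ (Fin d)) (xs : ℕ → EuclideanSpace ℝ (Fin d))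
    (μ σ : ℕ → EuclideanSpace ℝ (Fin d) → ℝ) (c : ℝ) (hc : 0 ≤ c)
    (h1 : ∀ t, 2 ≤ t → t ≤ T →
      f xstar ≤ min (lipUpper f L xs (t - 1) xstar)
        (μ (t - 1) xstar + c * σ (t - 1) xstar))
    (h2 : ∀ t, 2 ≤ t → t ≤ T →
      lipLower f L xs (t - 1) (xs t) ≤ μ (t - 1) (xs t) + c * σ (t - 1) (xs t) ∧
      μ (t - 1) (xs t) + c * σ (t - 1) (xs t) ≤ lipUpper f L xs (t - 1) (xs t))
    (h3 : ∀ t, 2 ≤ t → t ≤ T →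
      μ (t - 1) xstar + c * σ (t - 1) xstar ≤ μ (t - 1) (xs t) + c * σ (t - 1) (xs t))
    (h4 : ∀ t, 2 ≤ t → t ≤ T →
      |f (xs t) - μ (t - 1) (xs t)| ≤ c * σ (t - 1) (xs t)) :
    ∑ t ∈ Finset.Icc 2 T, (f xstar - f (xs t)) ≤
      min (2 * c * ∑ t ∈ Finset.Icc 2 T, σ (t - 1) (xs t))
          (2 * L * ∑ t ∈ Finset.Icc 2 T, nearestDist xs (t - 1) (xs t)) := by
  refine le_min ?_ ?_ <;> rw [Finset.mul_sum] <;> refine Finset.sum_le_sum fun t ht => ?_ <;>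
    obtain ⟨ht2, htT⟩ := Finset.mem_Icc.1 ht <;>
    have hopt := ((h1 t ht2 htT).trans (min_le_right _ _)).trans (h3 t ht2 htT)
  · have hconf := (abs_le.1 (h4 t ht2 htT)).1
    linarith
  · have hgap := lipUpper_le_add_nearestDist hf xs (show 1 ≤ t - 1 by omega) (xs t)
    linarith [(h2 t ht2 htT).2]
end

section
/- Let μ ∈ ℝ, σ > 0, y* ∈ ℝ, and let X be a real random variable with the Gaussian distribution of mean μ and variance σ². Then E[ max(X - y*, 0) ] = σ · ( z Φ(z) + φ(z) ), where z = (μ - y*)/σ, φ is the standard normal probability density function, and Φ is the standard normal cumulative distribution function. Equivalently, ∫_{y*}^{∞} (x - y*) · (1/(σ√(2π))) exp( -(x-μ)²/(2σ²) ) dx = σ ( z Φ(z) + φ(z) ). -/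
/-- The standard normal probability density function `φ(t) = (1/√(2π)) exp(-t²/2)`. -/
noncomputable def stdNormalPDF (t : ℝ) : ℝ :=
  (Real.sqrt (2 * Real.pi))⁻¹ * Real.exp (-t ^ 2 / 2)

/-- The standard normal cumulative distribution function `Φ(t) = ∫_{-∞}^t φ(u) du`. -/
noncomputable def stdNormalCDF (t : ℝ) : ℝ :=
  ∫ u in Set.Iic t, stdNormalPDF u

theorem integrable_stdNormalPDF : MeasureTheory.Integrable stdNormalPDF := by
  refine ((integrable_exp_neg_mul_sq (b := 1 / 2) (by norm_num)).const_mul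
    (Real.sqrt (2 * Real.pi))⁻¹).congr (.of_forall fun t => ?_)
  simp only [stdNormalPDF]
  ring_nf

theorem integrable_mul_stdNormalPDF :
    MeasureTheory.Integrable fun t => t * stdNormalPDF t := by
  refine ((integrable_mul_exp_neg_mul_sq (b := 1 / 2) (by norm_num)).const_mul
    (Real.sqrt (2 * Real.pi))⁻¹).congr (.of_forall fun t => ?_)
  simp only [stdNormalPDF]
  ring_nf

theorem hasDerivAt_stdNormalPDF (t : ℝ) :
    HasDerivAt stdNormalPDF (-(t * stdNormalPDF t)) t := by
  have h : HasDerivAt (fun t : ℝ => -t ^ 2 / 2) (-t) t :=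
    ((hasDerivAt_pow 2 t).neg.div_const 2).congr_deriv (by ring)
  refine (h.exp.const_mul (Real.sqrt (2 * Real.pi))⁻¹).congr_deriv ?_
  rw [stdNormalPDF]
  ring

theorem tendsto_stdNormalPDF_atBot : Filter.Tendsto stdNormalPDF Filter.atBot (nhds 0) :=
  MeasureTheory.tendsto_zero_of_hasDerivAt_of_integrableOn_Iic (a := 0)
    (fun t _ => hasDerivAt_stdNormalPDF t) integrable_mul_stdNormalPDF.neg.integrableOn
    integrable_stdNormalPDF.integrableOn

theorem integral_Iic_mul_stdNormalPDF (z : ℝ) :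
    ∫ t in Set.Iic z, t * stdNormalPDF t = -stdNormalPDF z := by
  have h := MeasureTheory.integral_Iic_of_hasDerivAt_of_tendsto'
    (fun t (_ : t ∈ Set.Iic z) => hasDerivAt_stdNormalPDF t)
    integrable_mul_stdNormalPDF.neg.integrableOn tendsto_stdNormalPDF_atBot
  rw [MeasureTheory.integral_neg, sub_zero] at h
  rw [← h, neg_neg]

theorem integral_Iic_sub_mul_stdNormalPDF (z : ℝ) :
    ∫ t in Set.Iic z, (z - t) * stdNormalPDF t = z * stdNormalCDF z + stdNormalPDF z := by
  simp only [sub_mul]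
  rw [MeasureTheory.integral_sub (integrable_stdNormalPDF.const_mul z).integrableOn
    integrable_mul_stdNormalPDF.integrableOn, MeasureTheory.integral_const_mul,
    integral_Iic_mul_stdNormalPDF, sub_neg_eq_add, stdNormalCDF]

theorem integral_eq_mul_integral_comp_sub_mul (f : ℝ → ℝ) (a : ℝ) {c : ℝ} (hc : 0 < c) :
    ∫ x, f x = c * ∫ t, f (a - c * t) := by
  rw [MeasureTheory.Measure.integral_comp_mul_left (fun x => f (a - x)),
    MeasureTheory.integral_sub_left_eq_self f, abs_of_pos (inv_pos.2 hc), smul_eq_mul,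
    mul_inv_cancel_left₀ hc.ne']

theorem integral_Ioi_sub_mul_gaussian (μ σ y : ℝ) (hσ : 0 < σ) :
    ∫ x in Set.Ioi y, (x - y) *
        ((σ * Real.sqrt (2 * Real.pi))⁻¹ * Real.exp (-(x - μ) ^ 2 / (2 * σ ^ 2))) =
      σ * ((μ - y) / σ * stdNormalCDF ((μ - y) / σ) + stdNormalPDF ((μ - y) / σ)) := by
  rw [← integral_Iic_sub_mul_stdNormalPDF, MeasureTheory.integral_Iic_eq_integral_Iio,
    ← MeasureTheory.integral_indicator measurableSet_Ioi,
    ← MeasureTheory.integral_indicator measurableSet_Iio,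
    integral_eq_mul_integral_comp_sub_mul _ μ hσ]
  congr 2 with t
  have hmem : μ - σ * t ∈ Set.Ioi y ↔ t ∈ Set.Iio ((μ - y) / σ) := by
    rw [Set.mem_Ioi, Set.mem_Iio, lt_div_iff₀ hσ]
    constructor <;> intro h <;> linarith
  have hexp : -(μ - σ * t - μ) ^ 2 / (2 * σ ^ 2) = -t ^ 2 / 2 := by
    field_simp
    ring
  simp only [Set.indicator_apply, hmem, hexp, stdNormalPDF]
  congr 1
  field_simp
  ring

/-- Closed form of the expected improvement: for `X ~ N(μ, σ²)` with
`σ > 0` and incumbent `y*`, with `z = (μ - y*)/σ`,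
`E[max(X - y*, 0)] = σ (z Φ(z) + φ(z))`; equivalently
`∫_{y*}^∞ (x - y*) (1/(σ√(2π))) exp(-(x-μ)²/(2σ²)) dx = σ (z Φ(z) + φ(z))`. -/
theorem expected_improvement_closed_form (μ σ ystar : ℝ) (hσ : 0 < σ) :
    (∫ x, max (x - ystar) 0
        ∂(ProbabilityTheory.gaussianReal μ ⟨σ ^ 2, sq_nonneg σ⟩) =
      σ * ((μ - ystar) / σ * stdNormalCDF ((μ - ystar) / σ) +
        stdNormalPDF ((μ - ystar) / σ))) ∧
    (∫ x in Set.Ioi ystar, (x - ystar) *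
        ((σ * Real.sqrt (2 * Real.pi))⁻¹ * Real.exp (-(x - μ) ^ 2 / (2 * σ ^ 2))) =
      σ * ((μ - ystar) / σ * stdNormalCDF ((μ - ystar) / σ) +
        stdNormalPDF ((μ - ystar) / σ))) := by
  have hv : (⟨σ ^ 2, sq_nonneg σ⟩ : NNReal) ≠ 0 :=
    fun h => pow_ne_zero 2 hσ.ne' (congrArg NNReal.toReal h)
  refine ⟨?_, integral_Ioi_sub_mul_gaussian μ σ ystar hσ⟩
  rw [← integral_Ioi_sub_mul_gaussian μ σ ystar hσ,
    ProbabilityTheory.integral_gaussianReal_eq_integral_smul hv,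
    ← MeasureTheory.integral_indicator measurableSet_Ioi]
  congr 1 with x
  have hpdf : ProbabilityTheory.gaussianPDFReal μ ⟨σ ^ 2, sq_nonneg σ⟩ x =
      (σ * Real.sqrt (2 * Real.pi))⁻¹ * Real.exp (-(x - μ) ^ 2 / (2 * σ ^ 2)) := by
    change (Real.sqrt (2 * Real.pi * σ ^ 2))⁻¹ * Real.exp (-(x - μ) ^ 2 / (2 * σ ^ 2)) = _
    rw [Real.sqrt_mul (by positivity), Real.sqrt_sq hσ.le, mul_comm σ]
  rw [hpdf, smul_eq_mul, mul_comm, Set.indicator_apply]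
  split_ifs with h
  · rw [max_eq_left (sub_nonneg.2 (Set.mem_Ioi.1 h).le)]
  · rw [max_eq_right (sub_nonpos.2 (not_lt.1 h)), zero_mul]
end
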